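/- For every integer n ≥ 1, the number q_n of Stirling derangements of order n satisfies q_{n+1} = 2n·(q_n + q_{n−1}), with q_0 = 1 and q_1 = 0. -/

import Mathlib

open scoped Classical
noncomputable section

/-- The multiset `{1,1,2,2,…,n,n}` as a list. -/
def baseList (n : ℕ) : List ℕ := (List.range n).flatMap (fun i => [i + 1, i + 1])

/-- A word is Stirling if whenever the same value occurs at positions `i < k`,
every entry strictly between them is greater than that value. -/
def IsStirlingWord (l : List ℕ) : Prop :=
  ∀ i j k : Fin l.length, i < j → j < k → l.get i = l.get k → l.get i < l.get j

/-- The set `Q_n` of Stirling permutations of order `n`:  rearrangements of the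
multiset `{1,1,2,2,…,n,n}` in which all entries between the two occurrences of any
value exceed that value. -/
def stirlingPerms (n : ℕ) : Finset (List ℕ) :=
  ((baseList n).permutations.toFinset).filter IsStirlingWord

/-- Number of descents of `σ ∈ Q_n`: indices `i ∈ {1,…,2n}` (here 0-based) with
`σ_i > σ_{i+1}`, with the convention `σ_{2n+1} = 0`. -/
def desList (l : List ℕ) : ℕ :=
  ((Finset.range l.length).filter (fun i => l.getD (i + 1) 0 < l.getD i 0)).card

/-- The second-order Eulerian polynomial `C_n(x) = ∑_{σ ∈ Q_n} x^{des σ}`. -/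
def Cpoly (n : ℕ) : Polynomial ℚ :=
  ∑ σ ∈ stirlingPerms n, Polynomial.X ^ desList σ

/-- A list of cycles is a valid standard cycle form of a Stirling permutation of the
second kind of order `n` if:  the cycles are disjoint and together use each of
`1,1,2,2,…,n,n` exactly once; both copies of any value lie in the same cycle; each
cycle starts with (one of) its smallest entries; the cycles are listed in increasing
order of their smallest (first) entries; and the word of each cycle reduces to a
Stirling permutation. -/
def IsStirling2 (n : ℕ) (c : List (List ℕ)) : Prop :=
  c.flatten.Perm (baseList n) ∧
  (∀ w ∈ c, w ≠ [] ∧ (∀ v ∈ w, w.count v = 2) ∧ (∀ v ∈ w, w.headI ≤ v) ∧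
      IsStirlingWord w) ∧
  c.Chain' (fun w₁ w₂ => w₁.headI < w₂.headI)

/-- The set `Q_n²` of Stirling permutations of the second kind of order `n`,
each recorded as its standard cycle form (a list of cycles). -/
def stirling2 (n : ℕ) : Finset (List (List ℕ)) :=
  ((((baseList n).permutations.toFinset) ×ˢ (Finset.univ : Finset (Composition (2 * n)))).image
      (fun p => p.1.splitWrtComposition p.2)).filter (IsStirling2 n)

/-- `cyc(σ)`: the number of cycles. -/
def cyc (c : List (List ℕ)) : ℕ := c.length

/-- `cplat(σ)`: the number of cycle plateaus, i.e. entries `c_i` of a cycle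
`(c_1,…,c_{2k})` with `c_i = c_{i+1}`, `1 ≤ i < 2k`. -/
def cplat (c : List (List ℕ)) : ℕ :=
  (c.map (fun w => ((Finset.range w.length).filter
    (fun i => i + 1 < w.length ∧ w.getD i 0 = w.getD (i + 1) 0)).card)).sum

/-- `casc(σ)`: the number of cycle ascents, i.e. entries `c_i` of a cycle
`(c_1,…,c_{2k})` with `c_i < c_{i+1}`, `1 ≤ i < 2k`. -/
def casc (c : List (List ℕ)) : ℕ :=
  (c.map (fun w => ((Finset.range w.length).filter
    (fun i => i + 1 < w.length ∧ w.getD i 0 < w.getD (i + 1) 0)).card)).sum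

/-- `cap(σ)`: the number of cycle ascent plateaus, i.e. entries `c_i` of a cycle
`(c_1,…,c_{2k})` with `c_{i-1} < c_i = c_{i+1}`, `2 ≤ i ≤ 2k-1`. -/
def capSt (c : List (List ℕ)) : ℕ :=
  (c.map (fun w => ((Finset.range w.length).filter
    (fun i => 0 < i ∧ i + 1 < w.length ∧
      w.getD (i - 1) 0 < w.getD i 0 ∧ w.getD i 0 = w.getD (i + 1) 0)).card)).sum

/-- `fix(σ)`: the number of fixed points, i.e. values `k` with `(k,k)` a cycle of `σ`. -/
def fixSt (c : List (List ℕ)) : ℕ :=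
  ((Finset.range c.length).filter (fun i => ∃ k : ℕ, c.getD i [] = [k, k])).card

/-- `q_n`: the number of Stirling derangements of order `n` (fixed-point-free
Stirling permutations of the second kind). -/
def qDer (n : ℕ) : ℕ := ((stirling2 n).filter (fun σ => fixSt σ = 0)).card

open List in
theorem isStirlingWord_iff_sublist (l : List ℕ) :
    IsStirlingWord l ↔ ∀ a b, [a, b, a] <+ l → a < b := by
  constructor
  · intro h a b hs
    obtain ⟨f, hf⟩ := List.sublist_iff_exists_fin_orderEmbedding_get_eq.1 hs
    have h0 := hf ⟨0, by simp⟩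
    have h1 := hf ⟨1, by simp⟩
    have h2 := hf ⟨2, by simp⟩
    simp only [List.get_eq_getElem, List.getElem_cons_zero, List.getElem_cons_succ] at h0 h1 h2
    have := h (f ⟨0, by simp⟩) (f ⟨1, by simp⟩) (f ⟨2, by simp⟩)
      (f.lt_iff_lt.2 (by simp)) (f.lt_iff_lt.2 (by simp))
      (by simp only [List.get_eq_getElem]; rw [← h0, ← h2])
    simp only [List.get_eq_getElem] at this
    rwa [← h0, ← h1] at this
  · intro h i j k hij hjk e
    refine h _ _ ?_
    have : [l.get i, l.get j, l.get k] <+ l := by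
      have := List.map_getElem_sublist (l := l) (is := [i, j, k])
        (by simp [hij, hjk, hij.trans hjk])
      simpa using this
    rwa [← e] at this

/-- A nonempty word that may occur as a cycle in standard form. -/
def IsCycleWord (w : List ℕ) : Prop :=
  w ≠ [] ∧ (∀ v ∈ w, w.count v = 2) ∧ (∀ v ∈ w, w.headI ≤ v) ∧ IsStirlingWord w

/-- The standard cycle forms using each element of `S` exactly twice. -/
def IsCycleForm (S : Finset ℕ) (c : List (List ℕ)) : Prop :=
  (∀ a, c.flatten.count a = if a ∈ S then 2 else 0) ∧ (∀ w ∈ c, IsCycleWord w) ∧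
    (c.map List.headI).Pairwise (· < ·)

/-- No cycle of `c` is a fixed point. -/
def IsDeranged (c : List (List ℕ)) : Prop := ∀ w ∈ c, ¬ ∃ k : ℕ, w = [k, k]

/-- The number of fixed points of `c`. -/
def fixCount (c : List (List ℕ)) : ℕ := c.countP (fun w => ∃ k : ℕ, w = [k, k])

theorem fixCount_eq_zero_iff (c : List (List ℕ)) : fixCount c = 0 ↔ IsDeranged c := by
  simp [fixCount, IsDeranged, List.countP_eq_zero]

/-- All ways to insert two adjacent copies of `m` in a word, not at the front. -/
def wordInsertions (m : ℕ) : List ℕ → List (List ℕ)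
  | [] => []
  | x :: w => (x :: m :: m :: w) :: (wordInsertions m w).map (x :: ·)

/-- All ways to insert two adjacent copies of `m` in one of the words of `c`, not at its front. -/
def cycleInsertions (m : ℕ) : List (List ℕ) → List (List (List ℕ))
  | [] => []
  | w :: c => (wordInsertions m w).map (· :: c) ++ (cycleInsertions m c).map (w :: ·)

theorem exists_of_mem_wordInsertions {m : ℕ} {w w' : List ℕ} (h : w' ∈ wordInsertions m w) :
    ∃ x u v, w = x :: (u ++ v) ∧ w' = x :: (u ++ m :: m :: v) := by
  induction w generalizing w' with
  | nil => simp [wordInsertions] at h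
  | cons x w ih =>
    simp only [wordInsertions, List.mem_cons, List.mem_map] at h
    rcases h with rfl | ⟨t, ht, rfl⟩
    · exact ⟨x, [], w, by simp⟩
    · obtain ⟨y, u, v, rfl, rfl⟩ := ih ht
      exact ⟨x, y :: u, v, by simp⟩

theorem exists_of_mem_cycleInsertions {m : ℕ} {c c' : List (List ℕ)}
    (h : c' ∈ cycleInsertions m c) :
    ∃ c₁ w w' c₂, c = c₁ ++ w :: c₂ ∧ c' = c₁ ++ w' :: c₂ ∧ w' ∈ wordInsertions m w := by
  induction c generalizing c' with
  | nil => simp [cycleInsertions] at h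
  | cons w c ih =>
    simp only [cycleInsertions, List.mem_append, List.mem_map] at h
    rcases h with ⟨t, ht, rfl⟩ | ⟨t, ht, rfl⟩
    · exact ⟨[], w, t, c, by simp [ht]⟩
    · obtain ⟨c₁, y, y', c₂, rfl, rfl, hy⟩ := ih ht
      exact ⟨w :: c₁, y, y', c₂, by simp [hy]⟩

theorem length_wordInsertions (m : ℕ) (w : List ℕ) : (wordInsertions m w).length = w.length := by
  induction w with
  | nil => rfl
  | cons x w ih => simp [wordInsertions, ih]

theorem not_fixed_of_mem_wordInsertions {m : ℕ} {w w' : List ℕ} (h : w' ∈ wordInsertions m w) :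
    ¬ ∃ k : ℕ, w' = [k, k] := by
  rintro ⟨k, hk⟩
  obtain ⟨x, u, v, rfl, rfl⟩ := exists_of_mem_wordInsertions h
  have := congrArg List.length hk
  simp at this
  omega

theorem nodup_wordInsertions {m : ℕ} {w : List ℕ} (hm : m ∉ w) : (wordInsertions m w).Nodup := by
  induction w with
  | nil => simp [wordInsertions]
  | cons x w ih =>
    simp only [List.mem_cons, not_or] at hm
    rw [wordInsertions, List.nodup_cons]
    refine ⟨?_, (ih hm.2).map (List.cons_injective)⟩
    intro h
    obtain ⟨t, ht, e⟩ := List.mem_map.1 h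
    obtain ⟨y, u, v, rfl, rfl⟩ := exists_of_mem_wordInsertions ht
    simp only [List.cons.injEq] at e
    simp [e.2.1] at hm

theorem nodup_cycleInsertions {m : ℕ} {c : List (List ℕ)} (hm : m ∉ c.flatten) :
    (cycleInsertions m c).Nodup := by
  induction c with
  | nil => simp [cycleInsertions]
  | cons w c ih =>
    simp only [List.flatten_cons, List.mem_append, not_or] at hm
    rw [cycleInsertions, List.nodup_append]
    refine ⟨(nodup_wordInsertions hm.1).map (fun a b h => by simpa using h),
      (ih hm.2).map List.cons_injective, ?_⟩
    intro a ha b hb e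
    obtain ⟨s, hs, rfl⟩ := List.mem_map.1 ha
    obtain ⟨t, ht, rfl⟩ := List.mem_map.1 hb
    obtain ⟨y, u, v, rfl, rfl⟩ := exists_of_mem_wordInsertions hs
    have := congrArg List.length (List.cons.inj e).1
    simp at this
    omega

theorem map_filter_eq_self {m : ℕ} {c : List (List ℕ)} (hm : m ∉ c.flatten) :
    c.map (List.filter (· ≠ m)) = c := by
  conv_rhs => rw [← List.map_id c]
  refine List.map_congr_left fun w hw => ?_
  rw [id, List.filter_eq_self]
  intro a ha
  have : a ≠ m := fun e => hm (e ▸ List.mem_flatten.2 ⟨w, hw, ha⟩)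
  simpa using this

theorem map_filter_of_mem_cycleInsertions {m : ℕ} {c c' : List (List ℕ)} (hm : m ∉ c.flatten)
    (h : c' ∈ cycleInsertions m c) : c'.map (List.filter (· ≠ m)) = c := by
  obtain ⟨c₁, w, w', c₂, rfl, rfl, hw⟩ := exists_of_mem_cycleInsertions h
  have e := map_filter_eq_self hm
  obtain ⟨x, u, v, rfl, rfl⟩ := exists_of_mem_wordInsertions hw
  rw [← e]
  simp [List.filter_cons]

theorem countP_cycleInsertions (m : ℕ) (c : List (List ℕ)) :
    (cycleInsertions m c).countP (fun c => IsDeranged c) =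
      if fixCount c = 0 then c.flatten.length else if fixCount c = 1 then 2 else 0 := by
  induction c with
  | nil => simp [cycleInsertions, fixCount]
  | cons w c ih =>
    rw [cycleInsertions, List.countP_append, List.countP_map, List.countP_map]
    have h1 : (wordInsertions m w).countP ((fun c => decide (IsDeranged c)) ∘ (· :: c)) =
        if fixCount c = 0 then w.length else 0 := by
      rw [List.countP_congr (q := fun _ => decide (fixCount c = 0))]
      · split_ifs with h <;> simp [h, length_wordInsertions]
      · intro t ht
        have := not_fixed_of_mem_wordInsertions ht
        simp only [fixCount_eq_zero_iff, Function.comp, decide_eq_true_eq, IsDeranged,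
          List.forall_mem_cons, this, not_false_eq_true, true_and]
    by_cases hw : ∃ k : ℕ, w = [k, k]
    · have h2 : (cycleInsertions m c).countP ((fun c => decide (IsDeranged c)) ∘ (w :: ·)) = 0 := by
        rw [List.countP_eq_zero]
        intro t _
        simp [IsDeranged, hw]
      have h3 : fixCount (w :: c) = fixCount c + 1 := by simp [fixCount, hw]
      rw [h1, h2, h3]
      obtain ⟨k, rfl⟩ := hw
      simp
    · have h2 : (cycleInsertions m c).countP ((fun c => decide (IsDeranged c)) ∘ (w :: ·)) =
          (cycleInsertions m c).countP (fun c => decide (IsDeranged c)) := by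
        refine List.countP_congr fun t _ => ?_
        have : IsDeranged (w :: t) ↔ IsDeranged t := by
          unfold IsDeranged
          rw [List.forall_mem_cons]
          exact and_iff_right hw
        simp only [Function.comp, decide_eq_true_eq, this]
      have h3 : fixCount (w :: c) = fixCount c := by simp [fixCount, hw]
      rw [h1, h2, h3, ih]
      split_ifs <;> simp

open List in
theorem not_sublist_insert {m b : ℕ} {u v : List ℕ} (hu : m ∉ u) (hv : m ∉ v) :
    ¬ [m, b, m] <+ u ++ m :: m :: v := by
  induction u with
  | nil =>
    have h1 : ∀ l : List ℕ, m ∈ l → ¬ l <+ v := fun l hl hs => hv (hs.subset hl)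
    simp [List.cons_sublist_cons', h1]
  | cons x u ih =>
    simp only [List.mem_cons, not_or] at hu
    intro h
    rw [List.cons_append, List.cons_sublist_cons'] at h
    rcases h with h | h
    · exact ih hu.2 h
    · exact hu.1 h.1

theorem IsCycleWord.of_mem_wordInsertions {m : ℕ} {w w' : List ℕ} (hw : IsCycleWord w)
    (hm : ∀ a ∈ w, a < m) (h : w' ∈ wordInsertions m w) : IsCycleWord w' := by
  have hmw : m ∉ w := fun hh => (hm m hh).false
  obtain ⟨x, u, v, rfl, rfl⟩ := exists_of_mem_wordInsertions h
  obtain ⟨-, h2, h3, h4⟩ := hw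
  have hc : ∀ a, (x :: (u ++ m :: m :: v)).count a =
      (x :: (u ++ v)).count a + if m = a then 2 else 0 := by
    intro a
    simp only [List.count_cons, List.count_append, beq_iff_eq]
    split_ifs <;> omega
  have hmem : ∀ a, a ∈ x :: (u ++ m :: m :: v) → a = m ∨ a ∈ x :: (u ++ v) := by
    intro a; simp; tauto
  refine ⟨by simp, ?_, ?_, ?_⟩
  · intro a ha
    rw [hc]
    by_cases e : m = a
    · subst e
      simp [List.count_eq_zero_of_not_mem hmw]
    · rw [if_neg e, h2 a ((hmem a ha).resolve_left fun h => e h.symm)]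
  · intro a ha
    rcases hmem a ha with rfl | h
    · exact (hm x (by simp)).le
    · exact h3 a h
  · rw [isStirlingWord_iff_sublist] at h4 ⊢
    intro a b hs
    have hmu : m ∉ x :: u := fun h => hmw (by simp at h ⊢; tauto)
    have hmv : m ∉ v := fun h => hmw (by simp [h])
    by_cases ha : a = m
    · subst ha
      exact absurd hs (not_sublist_insert hmu hmv)
    have ha' : a ∈ x :: (u ++ v) := (hmem a (hs.subset (by simp))).resolve_left ha
    by_cases hb : b = m
    · subst hb
      exact hm a ha'
    have hf := hs.filter (· ≠ m)
    have e : (x :: (u ++ m :: m :: v)).filter (· ≠ m) = (x :: (u ++ v)).filter (· ≠ m) := by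
      simp [List.filter_cons]
    rw [e] at hf
    apply h4
    refine List.Sublist.trans ?_ (hf.trans List.filter_sublist)
    simp [ha, hb]

theorem IsCycleForm.mem_flatten {S : Finset ℕ} {c : List (List ℕ)} (hc : IsCycleForm S c) {a : ℕ} :
    a ∈ c.flatten ↔ a ∈ S := by
  have := hc.1 a
  rw [← List.count_pos_iff, this]
  split_ifs with h <;> simp [h]

theorem IsCycleForm.of_mem_cycleInsertions {S : Finset ℕ} {m : ℕ} (hm : ∀ a ∈ S, a < m)
    {c c' : List (List ℕ)} (hc : IsCycleForm S c) (h : c' ∈ cycleInsertions m c) :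
    IsCycleForm (insert m S) c' := by
  have hmS : m ∉ S := fun h => (hm m h).false
  have hlt : ∀ w ∈ c, ∀ a ∈ w, a < m := fun w hw a ha =>
    hm a (hc.mem_flatten.1 (List.mem_flatten.2 ⟨w, hw, ha⟩))
  obtain ⟨c₁, w, w', c₂, rfl, rfl, hw⟩ := exists_of_mem_cycleInsertions h
  obtain ⟨h1, h2, h3⟩ := hc
  have hw' := (h2 w (by simp)).of_mem_wordInsertions (hlt w (by simp)) hw
  refine ⟨?_, ?_, ?_⟩
  · intro a
    have := h1 a
    obtain ⟨x, u, v, rfl, rfl⟩ := exists_of_mem_wordInsertions hw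
    simp only [List.flatten_append, List.flatten_cons, List.count_append, List.count_cons,
      Finset.mem_insert, beq_iff_eq] at this ⊢
    by_cases e : m = a
    · subst e
      simp only [hmS, true_or, if_true, if_false] at this ⊢
      omega
    · have e' : ¬ a = m := fun h => e h.symm
      simp only [e, e', if_false, false_or] at this ⊢
      omega
  · intro y hy
    simp only [List.mem_append, List.mem_cons] at hy
    rcases hy with hy | rfl | hy
    · exact h2 y (by simp [hy])
    · exact hw'
    · exact h2 y (by simp [hy])
  · obtain ⟨x, u, v, rfl, rfl⟩ := exists_of_mem_wordInsertions hw
    simpa using h3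

theorem IsCycleWord.filter_ne {m : ℕ} {w : List ℕ} (hw : IsCycleWord w) (hm : w.headI ≠ m) :
    IsCycleWord (w.filter (· ≠ m)) ∧ (w.filter (· ≠ m)).headI = w.headI := by
  obtain ⟨h1, h2, h3, h4⟩ := hw
  have hh : (w.filter (· ≠ m)).headI = w.headI ∧ w.filter (· ≠ m) ≠ [] := by
    cases w with
    | nil => simp at h1
    | cons x t =>
      have : x ≠ m := hm
      simp [this]
  refine ⟨⟨hh.2, ?_, ?_, ?_⟩, hh.1⟩
  · intro v hv
    rw [List.count_filter (p := fun x => decide (x ≠ m)) (List.mem_filter.1 hv).2]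
    exact h2 v (List.mem_filter.1 hv).1
  · intro v hv
    rw [hh.1]
    exact h3 v (List.mem_filter.1 hv).1
  · rw [isStirlingWord_iff_sublist] at h4 ⊢
    exact fun a b hs => h4 a b (hs.trans List.filter_sublist)

open List in
theorem mem_wordInsertions_filter {m : ℕ} {w : List ℕ} (hc : w.count m = 2) (hle : ∀ v ∈ w, v ≤ m)
    (hs : ∀ a b, [a, b, a] <+ w → a < b) (hh : w.headI ≠ m) :
    w ∈ wordInsertions m (w.filter (· ≠ m)) := by
  induction w with
  | nil => simp at hc
  | cons x t ih =>
    have hx : x ≠ m := hh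
    have hct : t.count m = 2 := by simpa [List.count_cons, hx] using hc
    have hf : (x :: t).filter (· ≠ m) = x :: t.filter (· ≠ m) := by simp [hx]
    rw [hf, wordInsertions, List.mem_cons]
    cases t with
    | nil => simp at hct
    | cons y t =>
      by_cases hy : y = m
      · subst hy
        left
        cases t with
        | nil => simp at hct
        | cons z t =>
          have hcz : (z :: t).count y = 1 := by simpa using hct
          by_cases hz : z = y
          · subst hz
            have : z ∉ t := by
              rw [← List.count_eq_zero]; simpa using hcz
            have : t.filter (· ≠ z) = t := by
              rw [List.filter_eq_self]
              intro a ha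
              have : a ≠ z := by rintro rfl; contradiction
              simpa using this
            simpa [List.filter_cons] using this.symm
          · exfalso
            have hmem : y ∈ t := by
              rw [← List.count_pos_iff]
              simp [hz] at hcz
              omega
            have h1 : y < z := by
              apply hs
              refine List.Sublist.cons _ ?_
              simpa using hmem
            have := hle z (by simp)
            omega
      · right
        refine List.mem_map_of_mem (ih hct (fun v hv => hle v (by simp at hv ⊢; tauto))
          (fun a b h => hs a b (h.cons _)) hy)

theorem mem_cycleInsertions_filter {m : ℕ} {c : List (List ℕ)} (hc : c.flatten.count m = 2)
    (hw : ∀ w ∈ c, IsCycleWord w) (hle : ∀ w ∈ c, ∀ v ∈ w, v ≤ m) (hh : ∀ w ∈ c, w.headI ≠ m) :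
    c ∈ cycleInsertions m (c.map (List.filter (· ≠ m))) := by
  induction c with
  | nil => simp at hc
  | cons w c ih =>
    rw [List.map_cons, cycleInsertions, List.mem_append, List.mem_map, List.mem_map]
    rw [List.flatten_cons, List.count_append] at hc
    have hww := hw w (by simp)
    by_cases hm : m ∈ w
    · left
      have h2 := hww.2.1 m hm
      refine ⟨w, mem_wordInsertions_filter h2 (hle w (by simp))
        ((isStirlingWord_iff_sublist w).1 hww.2.2.2) (hh w (by simp)), ?_⟩
      rw [map_filter_eq_self]
      rw [← List.count_eq_zero]
      omega
    · right
      have h0 := List.count_eq_zero_of_not_mem hm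
      refine ⟨c, ih (by omega) (fun w h => hw w (by simp [h])) (fun w h => hle w (by simp [h]))
        (fun w h => hh w (by simp [h])), ?_⟩
      congr 1
      have := map_filter_eq_self (m := m) (c := [w]) (by simpa using hm)
      exact (List.cons.inj this).1

theorem IsCycleForm.map_filter {S : Finset ℕ} {m : ℕ} (hm : ∀ a ∈ S, a < m)
    {c : List (List ℕ)} (hc : IsCycleForm (insert m S) c) (hd : IsDeranged c) :
    IsCycleForm S (c.map (List.filter (· ≠ m))) ∧
      c ∈ cycleInsertions m (c.map (List.filter (· ≠ m))) := by
  have hmS : m ∉ S := fun h => (hm m h).false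
  have hle : ∀ w ∈ c, ∀ v ∈ w, v ≤ m := by
    intro w hw a ha
    have := hc.mem_flatten.1 (List.mem_flatten.2 ⟨w, hw, ha⟩)
    rcases Finset.mem_insert.1 this with h | h
    · exact h.le
    · exact (hm a h).le
  obtain ⟨h1, h2, h3⟩ := hc
  have hh : ∀ w ∈ c, w.headI ≠ m := by
    intro w hw e
    obtain ⟨g1, g2, g3, -⟩ := h2 w hw
    have hall : ∀ v ∈ w, v = m := fun v hv => le_antisymm (hle w hw v hv) (e ▸ g3 v hv)
    have hrep := List.eq_replicate_of_mem hall
    have hmem : m ∈ w := by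
      cases w with
      | nil => simp at g1
      | cons x t => simp [hall x (by simp)]
    have hlen := g2 m hmem
    rw [hrep, List.count_replicate_self] at hlen
    rw [hlen] at hrep
    exact hd w hw ⟨m, hrep⟩
  refine ⟨⟨?_, ?_, ?_⟩, mem_cycleInsertions_filter (by simpa using h1 m) h2 hle hh⟩
  · intro a
    rw [← List.filter_flatten]
    by_cases e : a = m
    · subst e
      rw [if_neg hmS, List.count_eq_zero]
      simp
    · rw [List.count_filter (by simpa using e), h1 a]
      simp [e]
  · intro w hw
    obtain ⟨y, hy, rfl⟩ := List.mem_map.1 hw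
    exact ((h2 y hy).filter_ne (hh y hy)).1
  · rw [List.map_map]
    have e : c.map (List.headI ∘ List.filter (· ≠ m)) = c.map List.headI :=
      List.map_congr_left fun y hy => ((h2 y hy).filter_ne (hh y hy)).2
    rwa [e]

/-- The lists of nonempty words whose concatenation is a rearrangement of `l`. -/
def splittings (l : List ℕ) (n : ℕ) : Finset (List (List ℕ)) :=
  ((l.permutations.toFinset) ×ˢ (Finset.univ : Finset (Composition n))).image
    (fun p => p.1.splitWrtComposition p.2)

theorem mem_splittings {l : List ℕ} {n : ℕ} (hn : l.length = n) {c : List (List ℕ)}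
    (hp : c.flatten.Perm l) (hc : ∀ w ∈ c, w ≠ []) : c ∈ splittings l n := by
  have hl : c.flatten.length = n := hp.length_eq.trans hn
  subst hl
  refine Finset.mem_image.2 ⟨(c.flatten, ⟨c.map List.length, ?_, ?_⟩), ?_, ?_⟩
  · intro i hi
    obtain ⟨w, hw, rfl⟩ := List.mem_map.1 hi
    exact List.length_pos_iff.2 (hc w hw)
  · simp [List.length_flatten]
  · simpa using hp
  · exact List.splitWrtComposition_flatten c _ rfl

/-- The finite set of standard cycle forms on `S`. -/
def cycleForms (S : Finset ℕ) : Finset (List (List ℕ)) :=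
  (splittings (S.toList.flatMap fun a => [a, a]) (2 * S.card)).filter (IsCycleForm S)

/-- The finite set of fixed-point-free standard cycle forms on `S`. -/
def derangedForms (S : Finset ℕ) : Finset (List (List ℕ)) :=
  (cycleForms S).filter IsDeranged

theorem count_flatMap_pair (l : List ℕ) (a : ℕ) :
    (l.flatMap fun a => [a, a]).count a = 2 * l.count a := by
  induction l with
  | nil => simp
  | cons x l ih =>
    simp only [List.flatMap_cons, List.count_append, List.count_cons, ih, List.count_nil]
    split_ifs <;> omega

theorem IsCycleForm.perm {S : Finset ℕ} {c : List (List ℕ)} (hc : IsCycleForm S c) :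
    c.flatten.Perm (S.toList.flatMap fun a => [a, a]) := by
  rw [List.perm_iff_count]
  intro a
  rw [hc.1, count_flatMap_pair]
  split_ifs with h
  · rw [List.count_eq_one_of_mem S.nodup_toList (by simpa using h)]
  · rw [List.count_eq_zero_of_not_mem (by simpa using h)]

theorem length_flatMap_pair (l : List ℕ) : (l.flatMap fun a => [a, a]).length = 2 * l.length := by
  simp [List.length_flatMap, mul_comm]

theorem IsCycleForm.length_flatten {S : Finset ℕ} {c : List (List ℕ)} (hc : IsCycleForm S c) :
    c.flatten.length = 2 * S.card := by
  rw [hc.perm.length_eq, length_flatMap_pair, Finset.length_toList]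

theorem mem_cycleForms {S : Finset ℕ} {c : List (List ℕ)} :
    c ∈ cycleForms S ↔ IsCycleForm S c := by
  refine ⟨fun h => (Finset.mem_filter.1 h).2, fun h => Finset.mem_filter.2 ⟨?_, h⟩⟩
  exact mem_splittings (by rw [length_flatMap_pair, Finset.length_toList]) h.perm
    fun w hw => (h.2.1 w hw).1

theorem mem_derangedForms {S : Finset ℕ} {c : List (List ℕ)} :
    c ∈ derangedForms S ↔ IsCycleForm S c ∧ IsDeranged c := by
  rw [derangedForms, Finset.mem_filter, mem_cycleForms]

/-- Insert the fixed point `k` in a standard cycle form. -/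
def insertFixed (k : ℕ) (c : List (List ℕ)) : List (List ℕ) :=
  c.orderedInsert (fun v w => v.headI ≤ w.headI) [k, k]

theorem insertFixed_perm (k : ℕ) (c : List (List ℕ)) : (insertFixed k c).Perm ([k, k] :: c) :=
  List.perm_orderedInsert _ _ _

theorem eq_of_perm_of_pairwise_headI {c d : List (List ℕ)} (h : c.Perm d)
    (hc : (c.map List.headI).Pairwise (· < ·)) (hd : (d.map List.headI).Pairwise (· < ·)) :
    c = d := by
  rw [List.pairwise_map] at hc hd
  exact List.Perm.eq_of_pairwise (fun a b _ _ h1 h2 => absurd h1 h2.asymm) hc hd h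

theorem isCycleWord_pair (k : ℕ) : IsCycleWord [k, k] := by
  refine ⟨by simp, by simp, by simp, ?_⟩
  rw [isStirlingWord_iff_sublist]
  intro a b h
  simpa using h.length_le

theorem IsCycleForm.headI_mem {S : Finset ℕ} {c : List (List ℕ)} (hc : IsCycleForm S c)
    {w : List ℕ} (hw : w ∈ c) : w.headI ∈ S := by
  refine hc.mem_flatten.1 (List.mem_flatten.2 ⟨w, hw, ?_⟩)
  have := (hc.2.1 w hw).1
  cases w with
  | nil => simp at this
  | cons x t => simp

theorem IsCycleForm.insertFixed {S : Finset ℕ} {k : ℕ} (hk : k ∈ S) {c : List (List ℕ)}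
    (hc : IsCycleForm (S.erase k) c) : IsCycleForm S (insertFixed k c) := by
  have hp := insertFixed_perm k c
  refine ⟨?_, ?_, ?_⟩
  · intro a
    rw [hp.flatten.count_eq, List.flatten_cons, List.count_append, hc.1]
    by_cases e : a = k
    · subst e
      simp [hk]
    · have e' : ¬ k = a := fun h => e h.symm
      simp [e, e']
  · intro w hw
    rcases List.mem_cons.1 (hp.subset hw) with rfl | h
    · exact isCycleWord_pair k
    · exact hc.2.1 w h
  · have h1 : ((_root_.insertFixed k c).map List.headI).Pairwise (· ≤ ·) := by
      rw [List.pairwise_map]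
      have : Std.Total (fun v w : List ℕ => v.headI ≤ w.headI) := ⟨fun a b => le_total _ _⟩
      have : IsTrans _ (fun v w : List ℕ => v.headI ≤ w.headI) := ⟨fun a b c => le_trans⟩
      refine List.Pairwise.orderedInsert _ _ ?_
      have := hc.2.2
      rw [List.pairwise_map] at this
      exact this.imp le_of_lt
    have h2 : ((_root_.insertFixed k c).map List.headI).Nodup := by
      rw [(hp.map _).nodup_iff, List.map_cons, List.nodup_cons]
      refine ⟨?_, hc.2.2.imp ne_of_lt⟩
      intro h
      obtain ⟨w, hw, e⟩ := List.mem_map.1 h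
      have := hc.headI_mem hw
      rw [e] at this
      simp at this
    exact h1.imp₂ (fun _ _ h h' => lt_of_le_of_ne h h') h2

theorem IsCycleForm.erase {S : Finset ℕ} {k : ℕ} {c : List (List ℕ)} (hc : IsCycleForm S c)
    (hk : [k, k] ∈ c) : IsCycleForm (S.erase k) (c.erase [k, k]) := by
  have hp := List.perm_cons_erase hk
  have hkS : k ∈ S := hc.headI_mem hk
  refine ⟨?_, fun w hw => hc.2.1 w (List.mem_of_mem_erase hw),
    hc.2.2.sublist (List.erase_sublist.map _)⟩
  intro a
  have := hc.1 a
  rw [hp.flatten.count_eq, List.flatten_cons, List.count_append] at this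
  by_cases e : a = k
  · subst e
    simp [hkS] at this ⊢
    simpa using this
  · have e' : ¬ k = a := fun h => e h.symm
    simpa [e, e'] using this

theorem card_fixCount_eq_one (S : Finset ℕ) :
    ((cycleForms S).filter fun c => fixCount c = 1).card =
      ∑ k ∈ S, (derangedForms (S.erase k)).card := by
  rw [← Finset.card_sigma]
  symm
  refine Finset.card_bij (fun p _ => insertFixed p.1 p.2) ?_ ?_ ?_
  · rintro ⟨k, c⟩ h
    rw [Finset.mem_sigma, mem_derangedForms] at h
    rw [Finset.mem_filter, mem_cycleForms]
    refine ⟨h.2.1.insertFixed h.1, ?_⟩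
    have := (fixCount_eq_zero_iff c).2 h.2.2
    rw [fixCount] at this ⊢
    rw [(insertFixed_perm k c).countP_eq]
    simp [this]
  · rintro ⟨k, c⟩ h ⟨k', c'⟩ h' e
    rw [Finset.mem_sigma, mem_derangedForms] at h h'
    dsimp only at h h' e
    have hp : ([k, k] :: c).Perm ([k', k'] :: c') :=
      (insertFixed_perm k c).symm.trans (e ▸ insertFixed_perm k' c')
    have hk : k = k' := by
      rcases List.mem_cons.1 (hp.subset List.mem_cons_self) with hh | hh
      · simpa using hh
      · exact absurd ⟨k, rfl⟩ (h'.2.2 _ hh)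
    subst hk
    rw [eq_of_perm_of_pairwise_headI hp.cons_inv h.2.1.2.2 h'.2.1.2.2]
  · intro c h
    rw [Finset.mem_filter, mem_cycleForms] at h
    obtain ⟨hc, h1⟩ := h
    obtain ⟨w, hw, hk⟩ := List.countP_pos_iff.1 (h1.symm ▸ Nat.one_pos : 0 < fixCount c)
    obtain ⟨k, rfl⟩ := of_decide_eq_true hk
    have hkS : k ∈ S := hc.headI_mem hw
    have he := hc.erase hw
    have hp := List.perm_cons_erase hw
    refine ⟨⟨k, c.erase [k, k]⟩, ?_, ?_⟩
    · rw [Finset.mem_sigma, mem_derangedForms]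
      refine ⟨hkS, he, (fixCount_eq_zero_iff _).1 ?_⟩
      rw [fixCount, hp.countP_eq] at h1
      simpa [fixCount] using h1
    · exact eq_of_perm_of_pairwise_headI ((insertFixed_perm _ _).trans hp.symm)
        (he.insertFixed hkS).2.2 hc.2.2

theorem derangedForms_insert {S : Finset ℕ} {m : ℕ} (hm : ∀ a ∈ S, a < m) :
    derangedForms (insert m S) = (cycleForms S).biUnion
      fun c => ((cycleInsertions m c).filter fun c => IsDeranged c).toFinset := by
  ext c
  simp only [mem_derangedForms, Finset.mem_biUnion, mem_cycleForms, List.mem_toFinset,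
    List.mem_filter, decide_eq_true_eq]
  constructor
  · rintro ⟨h, hd⟩
    exact ⟨_, (h.map_filter hm hd).1, (h.map_filter hm hd).2, hd⟩
  · rintro ⟨d, hd, h, h'⟩
    exact ⟨hd.of_mem_cycleInsertions hm h, h'⟩

theorem card_derangedForms_insert {S : Finset ℕ} {m : ℕ} (hm : ∀ a ∈ S, a < m) :
    (derangedForms (insert m S)).card =
      2 * S.card * (derangedForms S).card + 2 * ∑ k ∈ S, (derangedForms (S.erase k)).card := by
  have hmc : ∀ c ∈ cycleForms S, m ∉ c.flatten := by
    intro c hc h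
    exact (hm m ((mem_cycleForms.1 hc).mem_flatten.1 h)).false
  rw [derangedForms_insert hm, Finset.card_biUnion]
  · rw [← card_fixCount_eq_one, derangedForms, Finset.card_filter, Finset.card_filter,
      Finset.mul_sum, Finset.mul_sum, ← Finset.sum_add_distrib]
    refine Finset.sum_congr rfl fun c hc => ?_
    rw [List.toFinset_card_of_nodup ((nodup_cycleInsertions (hmc c hc)).filter _),
      ← List.countP_eq_length_filter, countP_cycleInsertions,
      (mem_cycleForms.1 hc).length_flatten]
    simp only [← fixCount_eq_zero_iff]
    by_cases h0 : fixCount c = 0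
    · simp [h0]
    · simp [h0]
  · intro c hc d hd hne
    rw [Function.onFun, Finset.disjoint_left]
    intro e he he'
    rw [List.mem_toFinset, List.mem_filter] at he he'
    exact hne ((map_filter_of_mem_cycleInsertions (hmc c hc) he.1).symm.trans
      (map_filter_of_mem_cycleInsertions (hmc d hd) he'.1))

/-- The sequence defined by the recurrence for Stirling derangedForms. -/
def derangementSeq : ℕ → ℕ
  | 0 => 1
  | 1 => 0
  | n + 2 => 2 * (n + 1) * (derangementSeq (n + 1) + derangementSeq n)

theorem derangedForms_empty : derangedForms ∅ = {[]} := by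
  ext c
  rw [mem_derangedForms, Finset.mem_singleton]
  constructor
  · rintro ⟨h, -⟩
    have := h.length_flatten
    cases c with
    | nil => rfl
    | cons w c =>
      have hw := (h.2.1 w (by simp)).1
      simp at this
      exact absurd this.1 hw
  · rintro rfl
    exact ⟨⟨by simp, by simp, by simp⟩, by simp [IsDeranged]⟩

theorem card_derangedForms (n : ℕ) (S : Finset ℕ) (hS : S.card = n) :
    (derangedForms S).card = derangementSeq n := by
  induction n using Nat.strong_induction_on generalizing S with
  | _ n ih =>
    rcases S.eq_empty_or_nonempty with rfl | hne
    · simp at hS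
      subst hS
      simp [derangedForms_empty, derangementSeq]
    · have hmem := S.max'_mem hne
      have hm : ∀ a ∈ S.erase (S.max' hne), a < S.max' hne := fun a ha =>
        lt_of_le_of_ne (S.le_max' a (Finset.mem_of_mem_erase ha)) (Finset.ne_of_mem_erase ha)
      have hcard := Finset.card_erase_add_one hmem
      have key := card_derangedForms_insert hm
      rw [Finset.insert_erase hmem] at key
      generalize S.erase (S.max' hne) = T at key hcard
      rw [key, ih T.card (by omega) T rfl]
      have hsum : ∑ k ∈ T, (derangedForms (T.erase k)).card =
          ∑ _k ∈ T, derangementSeq (T.card - 1) :=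
        Finset.sum_congr rfl fun k hk =>
          ih _ (by omega) _ (Finset.card_erase_of_mem hk)
      rw [hsum, Finset.sum_const, smul_eq_mul]
      obtain rfl : n = T.card + 1 := by omega
      cases T.card with
      | zero => simp [derangementSeq]
      | succ k =>
        simp only [derangementSeq, Nat.add_sub_cancel]
        ring

theorem count_baseList (n a : ℕ) :
    (baseList n).count a = if a ∈ Finset.Icc 1 n then 2 else 0 := by
  have h : baseList n = ((List.range n).map (· + 1)).flatMap fun a => [a, a] := by
    simp [baseList, List.flatMap_map]
  have hnd : ((List.range n).map (· + 1)).Nodup :=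
    List.nodup_range.map (add_left_injective 1)
  have hmem : a ∈ (List.range n).map (· + 1) ↔ a ∈ Finset.Icc 1 n := by
    simp only [List.mem_map, List.mem_range, Finset.mem_Icc]
    exact ⟨fun ⟨b, hb, e⟩ => by omega, fun h => ⟨a - 1, by omega⟩⟩
  rw [h, count_flatMap_pair, hnd.count]
  simp only [hmem]
  split_ifs <;> rfl

theorem isStirling2_iff (n : ℕ) (c : List (List ℕ)) :
    IsStirling2 n c ↔ IsCycleForm (Finset.Icc 1 n) c := by
  have : IsTrans (List ℕ) (fun w₁ w₂ : List ℕ => w₁.headI < w₂.headI) :=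
    ⟨fun a b c => lt_trans⟩
  unfold IsStirling2 IsCycleForm IsCycleWord
  rw [List.perm_iff_count, List.pairwise_map]
  simp only [count_baseList]
  refine and_congr Iff.rfl (and_congr Iff.rfl ?_)
  exact List.isChain_iff_pairwise

theorem mem_stirling2 (n : ℕ) (c : List (List ℕ)) : c ∈ stirling2 n ↔ IsStirling2 n c := by
  refine ⟨fun h => (Finset.mem_filter.1 h).2, fun h => Finset.mem_filter.2 ⟨?_, h⟩⟩
  exact mem_splittings (by simp [baseList, List.length_flatMap, mul_comm]) h.1
    fun w hw => (h.2.1 w hw).1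

theorem fixSt_eq_zero_iff (c : List (List ℕ)) : fixSt c = 0 ↔ IsDeranged c := by
  rw [fixSt, Finset.card_eq_zero, Finset.filter_eq_empty_iff, IsDeranged,
    List.forall_mem_iff_getElem]
  simp only [Finset.mem_range]
  refine forall_congr' fun i => forall_congr' fun h => ?_
  rw [List.getD_eq_getElem _ _ h]

theorem qDer_eq (n : ℕ) : qDer n = derangementSeq n := by
  rw [← card_derangedForms n (Finset.Icc 1 n) (by simp), qDer]
  congr 1
  ext c
  rw [Finset.mem_filter, mem_stirling2, isStirling2_iff, fixSt_eq_zero_iff, mem_derangedForms]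

/-- `q_0 = 1`, `q_1 = 0`, and `q_{n+1} = 2n(q_n + q_{n-1})` for every `n ≥ 1`. -/
theorem stmt17 :
    qDer 0 = 1 ∧ qDer 1 = 0 ∧
    ∀ n : ℕ, 1 ≤ n → qDer (n + 1) = 2 * n * (qDer n + qDer (n - 1)) := by
  simp only [qDer_eq]
  refine ⟨rfl, rfl, fun n hn => ?_⟩
  obtain ⟨k, rfl⟩ := Nat.exists_eq_add_of_le' hn
  rfl
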